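/- Fix parameters ν₀ > 0, ε > 0, p ∈ (1, 2], γ ∈ {0, 1}, a measurable set Ω ⊆ ℝ^d, and a differentiable vector field u^k : ℝ^d → ℝ^d, and set ν_k(x) = ν₀ (ε² + |Du^k(x)|²)^{(p-2)/2}. Then for every differentiable vector field v : ℝ^d → ℝ^d, a'(u^k)(v, v) ≥ (1 + γ(p-2)) ∫_Ω ν_k |Dv|² dx, assuming all integrands appearing are integrable on Ω. -/

import Mathlib

open MeasureTheory Matrix

noncomputable def jac {d : ℕ} (u : (Fin d → ℝ) → (Fin d → ℝ)) (x : Fin d → ℝ) :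
    Matrix (Fin d) (Fin d) ℝ :=
  fun i j => fderiv ℝ u x (Pi.single j 1) i

noncomputable def strain {d : ℕ} (u : (Fin d → ℝ) → (Fin d → ℝ)) (x : Fin d → ℝ) :
    Matrix (Fin d) (Fin d) ℝ :=
  fun i j => (jac u x i j + jac u x j i) / 2

noncomputable def divg {d : ℕ} (u : (Fin d → ℝ) → (Fin d → ℝ)) (x : Fin d → ℝ) : ℝ :=
  ∑ i, jac u x i i

def frob {d : ℕ} (A B : Matrix (Fin d) (Fin d) ℝ) : ℝ := ∑ i, ∑ j, A i j * B i j

/-- The linearized viscous form a'(u^k)(v, v). -/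
noncomputable def aform {d : ℕ} (ν₀ ε p γ : ℝ) (Ω : Set (Fin d → ℝ))
    (uk v : (Fin d → ℝ) → (Fin d → ℝ)) : ℝ :=
  ∫ x in Ω,
    (ν₀ * (ε ^ 2 + frob (strain uk x) (strain uk x)) ^ ((p - 2) / 2) *
        frob (strain v x) (strain v x)
      + γ * (p - 2) * ν₀ *
          (ε ^ 2 + frob (strain uk x) (strain uk x)) ^ ((p - 4) / 2) *
          (frob (strain uk x) (strain v x)) ^ 2)

theorem frob_self_nonneg {d : ℕ} (A : Matrix (Fin d) (Fin d) ℝ) : 0 ≤ frob A A :=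
  Finset.sum_nonneg fun _ _ => Finset.sum_nonneg fun _ _ => mul_self_nonneg _

/-- The Cauchy–Schwarz inequality for the Frobenius inner product. -/
theorem frob_sq_le {d : ℕ} (A B : Matrix (Fin d) (Fin d) ℝ) :
    frob A B ^ 2 ≤ frob A A * frob B B := by
  simp only [frob, ← Fintype.sum_prod_type', ← pow_two]
  exact Finset.sum_mul_sq_le_sq_mul_sq _ (fun q : Fin d × Fin d => A q.1 q.2) fun q => B q.1 q.2

/-- The pointwise lower bound for the integrand of the linearized viscous form. -/
theorem weighted_frob_le {d : ℕ} {ν₀ ε p γ : ℝ} (hν₀ : 0 ≤ ν₀) (hε : ε ≠ 0) (hp : p ≤ 2)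
    (hγ : 0 ≤ γ) (A B : Matrix (Fin d) (Fin d) ℝ) :
    (1 + γ * (p - 2)) * ((ν₀ * (ε ^ 2 + frob A A) ^ ((p - 2) / 2)) * frob B B) ≤
      ν₀ * (ε ^ 2 + frob A A) ^ ((p - 2) / 2) * frob B B
        + γ * (p - 2) * ν₀ * (ε ^ 2 + frob A A) ^ ((p - 4) / 2) * frob A B ^ 2 := by
  have hs : 0 < ε ^ 2 + frob A A := add_pos_of_pos_of_nonneg (by positivity) (frob_self_nonneg A)
  have hcs : frob A B ^ 2 ≤ (ε ^ 2 + frob A A) * frob B B := by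
    nlinarith [frob_sq_le A B, mul_nonneg (sq_nonneg ε) (frob_self_nonneg B)]
  have hpow : (ε ^ 2 + frob A A) ^ ((p - 2) / 2) =
      (ε ^ 2 + frob A A) ^ ((p - 4) / 2) * (ε ^ 2 + frob A A) := by
    rw [← Real.rpow_add_one hs.ne']
    ring_nf
  have hcoef : 0 ≤ γ * (2 - p) * ν₀ * (ε ^ 2 + frob A A) ^ ((p - 4) / 2) := by
    have : 0 ≤ 2 - p := by linarith
    positivity
  rw [hpow]
  linear_combination mul_le_mul_of_nonneg_left hcs hcoef

/-- First inequality of Lemma 4.3(i):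
`a'(u^k)(v, v) ≥ (1 + γ(p-2)) ‖ν_k^{1/2} Dv‖²`. -/
theorem aform_ge_weighted_strain {d : ℕ} (ν₀ ε p γ : ℝ)
    (hν₀ : 0 < ν₀) (hε : 0 < ε) (hp1 : 1 < p) (hp2 : p ≤ 2)
    (hγ : γ = 0 ∨ γ = 1)
    (Ω : Set (Fin d → ℝ)) (hΩ : MeasurableSet Ω)
    (uk : (Fin d → ℝ) → (Fin d → ℝ)) (huk : Differentiable ℝ uk)
    (v : (Fin d → ℝ) → (Fin d → ℝ)) (hv : Differentiable ℝ v)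
    (haint : IntegrableOn (fun x =>
      ν₀ * (ε ^ 2 + frob (strain uk x) (strain uk x)) ^ ((p - 2) / 2) *
          frob (strain v x) (strain v x)
        + γ * (p - 2) * ν₀ *
            (ε ^ 2 + frob (strain uk x) (strain uk x)) ^ ((p - 4) / 2) *
            (frob (strain uk x) (strain v x)) ^ 2) Ω)
    (hnuDv2 : IntegrableOn (fun x =>
      (ν₀ * (ε ^ 2 + frob (strain uk x) (strain uk x)) ^ ((p - 2) / 2)) * frob (strain v x) (strain v x)) Ω) :
    aform ν₀ ε p γ Ω uk v ≥
      (1 + γ * (p - 2)) *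
        ∫ x in Ω, (ν₀ * (ε ^ 2 + frob (strain uk x) (strain uk x)) ^ ((p - 2) / 2)) *
          frob (strain v x) (strain v x) := by
  have hγ0 : 0 ≤ γ := by rcases hγ with rfl | rfl <;> norm_num
  rw [aform, ge_iff_le, ← integral_const_mul]
  exact integral_mono (hnuDv2.const_mul _) haint fun x =>
    weighted_frob_le hν₀.le hε.ne' hp2 hγ0 (strain uk x) (strain v x)
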